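/- Let X ⊆ ℝⁿ be open, p, q_j, g_j : X → Mat(N,ℂ) smooth for j ≥ 1, and γ_j → γ in X with det p(γ) ≠ 0 and det p(γ_j) ≠ 0 for all j. Suppose there is a smooth q : X → Mat(N,ℂ) with ∂^α q(γ) = lim_j ∂^α q_j(γ_j) for every multi-index α. If q_j − p·g_j vanishes of infinite order at γ_j for every j, then there is a smooth g : X → Mat(N,ℂ) such that q − p·g vanishes of infinite order at γ and ∂^α g(γ) = lim_j ∂^α g_j(γ_j) for all multi-indices α. -/

import Mathlib

open Filter

/-- First-order partial derivative in the `i`-th coordinate direction, within `X`. -/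
noncomputable def pderivOn {n : ℕ} (X : Set (Fin n → ℝ)) (i : Fin n)
    (f : (Fin n → ℝ) → ℂ) : (Fin n → ℝ) → ℂ :=
  fun x => fderivWithin ℝ f X x (Pi.single i 1)

/-- Iterated (multi-index) partial derivative `∂^α`, the multi-index being recorded
as a list of coordinate directions. -/
noncomputable def mderivOn {n : ℕ} (X : Set (Fin n → ℝ)) (α : List (Fin n))
    (f : (Fin n → ℝ) → ℂ) : (Fin n → ℝ) → ℂ :=
  α.foldr (pderivOn X) f

section MultiDerivatives

variable {n : ℕ} {X : Set (Fin n → ℝ)}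

theorem mderivOn_append_singleton (α : List (Fin n)) (i : Fin n) (f : (Fin n → ℝ) → ℂ) :
    mderivOn X (α ++ [i]) f = mderivOn X α (pderivOn X i f) := by
  simp [mderivOn]

theorem Filter.EventuallyEq.mderivOn {f g : (Fin n → ℝ) → ℂ} {x : Fin n → ℝ}
    (h : f =ᶠ[nhds x] g) (α : List (Fin n)) :
    mderivOn X α f =ᶠ[nhds x] mderivOn X α g := by
  induction α with
  | nil => exact h
  | cons i α ih =>
    filter_upwards [eventually_eventually_nhds.2 ih] with y hy
    exact congrArg (fun L : (Fin n → ℝ) →L[ℝ] ℂ => L (Pi.single i 1))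
      (Filter.EventuallyEq.fderivWithin_eq_of_nhds hy)

theorem mderivOn_congr (hX : IsOpen X) {f g : (Fin n → ℝ) → ℂ} (h : Set.EqOn f g X)
    (α : List (Fin n)) {x : Fin n → ℝ} (hx : x ∈ X) : mderivOn X α f x = mderivOn X α g x :=
  ((h.eventuallyEq_of_mem (hX.mem_nhds hx)).mderivOn α).eq_of_nhds

theorem ContDiffOn.pderivOn (hX : IsOpen X) {f : (Fin n → ℝ) → ℂ}
    (hf : ContDiffOn ℝ (⊤ : ℕ∞) f X) (i : Fin n) : ContDiffOn ℝ (⊤ : ℕ∞) (pderivOn X i f) X :=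
  (hf.fderivWithin hX.uniqueDiffOn (by simp)).clm_apply contDiffOn_const

theorem ContDiffOn.mderivOn (hX : IsOpen X) {f : (Fin n → ℝ) → ℂ}
    (hf : ContDiffOn ℝ (⊤ : ℕ∞) f X) (α : List (Fin n)) :
    ContDiffOn ℝ (⊤ : ℕ∞) (mderivOn X α f) X := by
  induction α with
  | nil => exact hf
  | cons i α ih => exact ih.pderivOn hX i

theorem pderivOn_add (hX : IsOpen X) {f g : (Fin n → ℝ) → ℂ}
    (hf : ContDiffOn ℝ (⊤ : ℕ∞) f X) (hg : ContDiffOn ℝ (⊤ : ℕ∞) g X) (i : Fin n) :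
    Set.EqOn (pderivOn X i (fun x => f x + g x))
      (fun x => pderivOn X i f x + pderivOn X i g x) X := by
  intro x hx
  simp only [pderivOn]
  rw [fderivWithin_fun_add (hX.uniqueDiffWithinAt hx) (hf.differentiableOn (by simp) x hx)
    (hg.differentiableOn (by simp) x hx)]
  rfl

theorem pderivOn_mul (hX : IsOpen X) {f g : (Fin n → ℝ) → ℂ}
    (hf : ContDiffOn ℝ (⊤ : ℕ∞) f X) (hg : ContDiffOn ℝ (⊤ : ℕ∞) g X) (i : Fin n) :
    Set.EqOn (pderivOn X i (fun x => f x * g x))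
      (fun x => f x * pderivOn X i g x + g x * pderivOn X i f x) X := by
  intro x hx
  simp only [pderivOn]
  rw [fderivWithin_fun_mul (hX.uniqueDiffWithinAt hx) (hf.differentiableOn (by simp) x hx)
    (hg.differentiableOn (by simp) x hx)]
  rfl

theorem mderivOn_zero (α : List (Fin n)) : mderivOn X α (fun _ => 0) = fun _ => 0 := by
  induction α with
  | nil => rfl
  | cons i α ih =>
    change pderivOn X i (mderivOn X α _) = _
    rw [ih]
    ext x
    simp [pderivOn]

theorem mderivOn_add (hX : IsOpen X) {f g : (Fin n → ℝ) → ℂ}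
    (hf : ContDiffOn ℝ (⊤ : ℕ∞) f X) (hg : ContDiffOn ℝ (⊤ : ℕ∞) g X) (α : List (Fin n)) :
    Set.EqOn (mderivOn X α (fun x => f x + g x))
      (fun x => mderivOn X α f x + mderivOn X α g x) X := by
  induction α using List.reverseRecOn generalizing f g with
  | nil => exact fun _ _ => rfl
  | append_singleton α i ih =>
    intro x hx
    simp only [mderivOn_append_singleton]
    rw [mderivOn_congr hX (pderivOn_add hX hf hg i) α hx]
    exact ih (hf.pderivOn hX i) (hg.pderivOn hX i) hx

/-- Smooth functions `u k` on `X` whose partial derivatives of every order at `γs k` converge to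
those of the smooth function `v` at `γ`. -/
structure JetTendsto (X : Set (Fin n → ℝ)) (γs : ℕ → Fin n → ℝ) (γ : Fin n → ℝ)
    (u : ℕ → (Fin n → ℝ) → ℂ) (v : (Fin n → ℝ) → ℂ) : Prop where
  contDiffOn_seq : ∀ k, ContDiffOn ℝ (⊤ : ℕ∞) (u k) X
  contDiffOn_lim : ContDiffOn ℝ (⊤ : ℕ∞) v X
  tendsto : ∀ α, Tendsto (fun k => mderivOn X α (u k) (γs k)) atTop (nhds (mderivOn X α v γ))

namespace JetTendsto

variable {γs : ℕ → Fin n → ℝ} {γ : Fin n → ℝ} {u u' : ℕ → (Fin n → ℝ) → ℂ}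
  {v v' : (Fin n → ℝ) → ℂ}

theorem const (hX : IsOpen X) (hγ : γ ∈ X) (htend : Tendsto γs atTop (nhds γ))
    (hv : ContDiffOn ℝ (⊤ : ℕ∞) v X) : JetTendsto X γs γ (fun _ => v) v where
  contDiffOn_seq _ := hv
  contDiffOn_lim := hv
  tendsto α := ((hv.mderivOn hX α).continuousOn.continuousAt (hX.mem_nhds hγ)).tendsto.comp htend

theorem pderivOn (hX : IsOpen X) (h : JetTendsto X γs γ u v) (i : Fin n) :
    JetTendsto X γs γ (fun k => pderivOn X i (u k)) (pderivOn X i v) where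
  contDiffOn_seq k := (h.contDiffOn_seq k).pderivOn hX i
  contDiffOn_lim := h.contDiffOn_lim.pderivOn hX i
  tendsto α := by simpa only [mderivOn_append_singleton] using h.tendsto (α ++ [i])

theorem add (hX : IsOpen X) (hγ : γ ∈ X) (hγs : ∀ k, γs k ∈ X) (h : JetTendsto X γs γ u v)
    (h' : JetTendsto X γs γ u' v') :
    JetTendsto X γs γ (fun k x => u k x + u' k x) (fun x => v x + v' x) where
  contDiffOn_seq k := (h.contDiffOn_seq k).add (h'.contDiffOn_seq k)
  contDiffOn_lim := h.contDiffOn_lim.add h'.contDiffOn_lim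
  tendsto α := by
    rw [mderivOn_add hX h.contDiffOn_lim h'.contDiffOn_lim α hγ]
    refine ((h.tendsto α).add (h'.tendsto α)).congr fun k => ?_
    exact (mderivOn_add hX (h.contDiffOn_seq k) (h'.contDiffOn_seq k) α (hγs k)).symm

theorem mul (hX : IsOpen X) (hγ : γ ∈ X) (hγs : ∀ k, γs k ∈ X) (h : JetTendsto X γs γ u v)
    (h' : JetTendsto X γs γ u' v') :
    JetTendsto X γs γ (fun k x => u k x * u' k x) (fun x => v x * v' x) where
  contDiffOn_seq k := (h.contDiffOn_seq k).mul (h'.contDiffOn_seq k)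
  contDiffOn_lim := h.contDiffOn_lim.mul h'.contDiffOn_lim
  tendsto α := by
    induction α using List.reverseRecOn generalizing u u' v v' with
    | nil => exact (h.tendsto []).mul (h'.tendsto [])
    | append_singleton α i ih =>
      simp only [mderivOn_append_singleton]
      have hleib : ∀ {f g : (Fin n → ℝ) → ℂ}, ContDiffOn ℝ (⊤ : ℕ∞) f X →
          ContDiffOn ℝ (⊤ : ℕ∞) g X → ∀ {x}, x ∈ X →
          mderivOn X α (_root_.pderivOn X i (fun x => f x * g x)) x =
            mderivOn X α (fun x => f x * _root_.pderivOn X i g x) x +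
              mderivOn X α (fun x => g x * _root_.pderivOn X i f x) x := by
        intro f g hf hg x hx
        rw [mderivOn_congr hX (pderivOn_mul hX hf hg i) α hx]
        exact mderivOn_add hX (hf.mul (hg.pderivOn hX i)) (hg.mul (hf.pderivOn hX i)) α hx
      rw [hleib h.contDiffOn_lim h'.contDiffOn_lim hγ]
      refine ((ih h (h'.pderivOn hX i)).add (ih h' (h.pderivOn hX i))).congr fun k => ?_
      exact (hleib (h.contDiffOn_seq k) (h'.contDiffOn_seq k) (hγs k)).symm

theorem sum (hX : IsOpen X) (hγ : γ ∈ X) (hγs : ∀ k, γs k ∈ X)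
    (htend : Tendsto γs atTop (nhds γ)) {ι : Type*} (s : Finset ι)
    {u : ι → ℕ → (Fin n → ℝ) → ℂ} {v : ι → (Fin n → ℝ) → ℂ}
    (h : ∀ l, JetTendsto X γs γ (u l) (v l)) :
    JetTendsto X γs γ (fun k x => ∑ l ∈ s, u l k x) (fun x => ∑ l ∈ s, v l x) := by
  classical
  induction s using Finset.induction_on with
  | empty => simpa using const hX hγ htend contDiffOn_const
  | insert a s ha ih =>
    simp only [Finset.sum_insert ha]
    exact (h a).add hX hγ hγs ih

end JetTendsto

end MultiDerivatives

section SmoothMatrices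

variable {E : Type*} [NormedAddCommGroup E] [NormedSpace ℝ E] {ι : Type*} [Fintype ι]
  [DecidableEq ι] {X : Set E} {m : WithTop ℕ∞} {A : E → Matrix ι ι ℂ}

theorem ContDiffOn.matrix_det (hA : ∀ i j, ContDiffOn ℝ m (fun x => A x i j) X) :
    ContDiffOn ℝ m (fun x => (A x).det) X := by
  simp only [Matrix.det_apply]
  exact ContDiffOn.sum fun σ _ => (contDiffOn_prod fun i _ => hA _ _).const_smul _

theorem ContDiffOn.matrix_adjugate (hA : ∀ i j, ContDiffOn ℝ m (fun x => A x i j) X) (i j : ι) :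
    ContDiffOn ℝ m (fun x => (A x).adjugate i j) X := by
  simp only [Matrix.adjugate_apply]
  refine ContDiffOn.matrix_det fun a b => ?_
  by_cases h : a = j
  · subst h
    simpa using contDiffOn_const
  · simpa [Matrix.updateRow_ne h] using hA a b

/-- Near a point where it is invertible, a smooth matrix function has a smooth inverse which
extends to the whole domain. -/
theorem exists_contDiffOn_eventually_inverse [FiniteDimensional ℝ E] (hX : IsOpen X)
    (hA : ∀ i j, ContDiffOn ℝ (⊤ : ℕ∞) (fun x => A x i j) X) {c : E} (hc : c ∈ X)
    (hdet : (A c).det ≠ 0) :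
    ∃ B : E → Matrix ι ι ℂ, (∀ i j, ContDiffOn ℝ (⊤ : ℕ∞) (fun x => B x i j) X) ∧
      ∀ᶠ x in nhds c, B x * A x = 1 ∧ A x * B x = 1 := by
  have hd : ContDiffOn ℝ (⊤ : ℕ∞) (fun x => (A x).det) X := ContDiffOn.matrix_det hA
  have hne : ∀ᶠ x in nhds c, (A x).det ≠ 0 :=
    (hd.continuousOn.continuousAt (hX.mem_nhds hc)).eventually_ne hdet
  obtain ⟨ε, hε, hball⟩ := Metric.nhds_basis_closedBall.eventually_iff.1 hne
  let χ : ContDiffBump c := ⟨ε / 2, ε, half_pos hε, half_lt_self hε⟩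
  have hφ : ContDiffOn ℝ (⊤ : ℕ∞) (fun x => (χ x : ℂ) * ((A x).det)⁻¹) X := by
    intro x hx
    refine ContDiffAt.contDiffWithinAt ?_
    by_cases hxs : x ∈ tsupport χ
    · rw [χ.tsupport_eq] at hxs
      exact (Complex.ofRealCLM.contDiff.contDiffAt.comp x χ.contDiff.contDiffAt).mul
        ((hd.contDiffAt (hX.mem_nhds hx)).inv (hball hxs))
    · refine (contDiffAt_const (c := (0 : ℂ))).congr_of_eventuallyEq ?_
      filter_upwards [notMem_tsupport_iff_eventuallyEq.1 hxs] with y hy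
      simp [hy]
  refine ⟨fun x => ((χ x : ℂ) * ((A x).det)⁻¹) • (A x).adjugate, fun i j => ?_, ?_⟩
  · simpa only [Matrix.smul_apply, smul_eq_mul] using
      hφ.mul (ContDiffOn.matrix_adjugate hA i j)
  · filter_upwards [hne, χ.eventuallyEq_one] with x hx hχ
    simp [hχ, Matrix.adjugate_mul, Matrix.mul_adjugate, smul_smul, hx]

end SmoothMatrices

/-- elliptic division with limits. If `det p(γ) ≠ 0`, `det p(γ_j) ≠ 0`,
the derivatives of `q_j` at `γ_j` converge to those of `q` at `γ`, and `q_j − p g_j`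
is flat at `γ_j`, then there is a smooth `g` with `q − p g` flat at `γ` and
`∂^α g(γ) = lim_j ∂^α g_j(γ_j)` for all multi-indices. -/
theorem stmt_11 {n N : ℕ} (X : Set (Fin n → ℝ)) (hX : IsOpen X)
    (p q : (Fin n → ℝ) → Matrix (Fin N) (Fin N) ℂ)
    (qs gs : ℕ → (Fin n → ℝ) → Matrix (Fin N) (Fin N) ℂ)
    (γ : Fin n → ℝ) (γs : ℕ → Fin n → ℝ)
    (hγ : γ ∈ X) (hγs : ∀ j, γs j ∈ X)
    (htend : Tendsto γs atTop (nhds γ))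
    (hp : ContDiffOn ℝ (⊤ : ℕ∞) (fun x => (fun i j => p x i j : Fin N → Fin N → ℂ)) X)
    (hq : ContDiffOn ℝ (⊤ : ℕ∞) (fun x => (fun i j => q x i j : Fin N → Fin N → ℂ)) X)
    (hqs : ∀ k, ContDiffOn ℝ (⊤ : ℕ∞) (fun x => (fun i j => qs k x i j : Fin N → Fin N → ℂ)) X)
    (hgs : ∀ k, ContDiffOn ℝ (⊤ : ℕ∞) (fun x => (fun i j => gs k x i j : Fin N → Fin N → ℂ)) X)
    (hdet : (p γ).det ≠ 0) (hdetj : ∀ j, (p (γs j)).det ≠ 0)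
    (hqlim : ∀ (α : List (Fin n)) (i j : Fin N),
      Tendsto (fun k => mderivOn X α (fun x => qs k x i j) (γs k)) atTop
        (nhds (mderivOn X α (fun x => q x i j) γ)))
    (hflat : ∀ (k : ℕ) (α : List (Fin n)) (i j : Fin N),
      mderivOn X α (fun x => (qs k x - p x * gs k x) i j) (γs k) = 0) :
    ∃ g : (Fin n → ℝ) → Matrix (Fin N) (Fin N) ℂ,
      ContDiffOn ℝ (⊤ : ℕ∞) (fun x => (fun i j => g x i j : Fin N → Fin N → ℂ)) X ∧
      (∀ (α : List (Fin n)) (i j : Fin N),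
        mderivOn X α (fun x => (q x - p x * g x) i j) γ = 0) ∧
      (∀ (α : List (Fin n)) (i j : Fin N),
        Tendsto (fun k => mderivOn X α (fun x => gs k x i j) (γs k)) atTop
          (nhds (mderivOn X α (fun x => g x i j) γ))) := by
  have entry : ∀ {A : (Fin n → ℝ) → Matrix (Fin N) (Fin N) ℂ},
      ContDiffOn ℝ (⊤ : ℕ∞) (fun x => (fun i j => A x i j : Fin N → Fin N → ℂ)) X →
      ∀ i j, ContDiffOn ℝ (⊤ : ℕ∞) (fun x => A x i j) X :=
    fun h i j => contDiffOn_pi.1 (contDiffOn_pi.1 h i) j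
  obtain ⟨r, hr, hinv⟩ := exists_contDiffOn_eventually_inverse hX (entry hp) hγ hdet
  have hrconst (i j : Fin N) := JetTendsto.const (γs := γs) hX hγ htend (hr i j)
  have hres_smooth (k : ℕ) (i j : Fin N) :
      ContDiffOn ℝ (⊤ : ℕ∞) (fun x => (qs k x - p x * gs k x) i j) X := by
    simp only [Matrix.sub_apply, Matrix.mul_apply]
    exact (entry (hqs k) i j).sub
      (ContDiffOn.sum fun l _ => (entry hp i l).mul (entry (hgs k) l j))
  have hmain (i j : Fin N) : JetTendsto X γs γ
      (fun k x => ∑ l, r x i l * (qs k x l j + (-1) * (qs k x - p x * gs k x) l j))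
      (fun x => ∑ l, r x i l * (q x l j + (-1) * 0)) := by
    refine JetTendsto.sum hX hγ hγs htend _ fun l => (hrconst i l).mul hX hγ hγs ?_
    refine JetTendsto.add hX hγ hγs
      ⟨fun k => entry (hqs k) l j, entry hq l j, fun α => hqlim α l j⟩ ?_
    refine (JetTendsto.const hX hγ htend contDiffOn_const).mul hX hγ hγs
      ⟨fun k => hres_smooth k l j, contDiffOn_const, fun α => ?_⟩
    simp only [hflat, mderivOn_zero, tendsto_const_nhds]
  have hlim (i j : Fin N) : (fun x => ∑ l, r x i l * (q x l j + (-1) * 0)) =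
      fun x => (r x * q x) i j := by
    ext x
    simp [Matrix.mul_apply]
  refine ⟨fun x => r x * q x, ?_, fun α i j => ?_, fun α i j => ?_⟩
  · refine contDiffOn_pi.2 fun i => contDiffOn_pi.2 fun j => ?_
    exact hlim i j ▸ (hmain i j).contDiffOn_lim
  · have hzero : (fun x => (q x - p x * (r x * q x)) i j) =ᶠ[nhds γ] fun _ => 0 := by
      filter_upwards [hinv] with x hx
      simp [← Matrix.mul_assoc, hx.2]
    rw [(hzero.mderivOn α).eq_of_nhds, mderivOn_zero]
  · rw [← hlim]
    refine ((hmain i j).tendsto α).congr' ?_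
    filter_upwards [htend.eventually (eventually_eventually_nhds.2 hinv)] with k hk
    refine (Filter.EventuallyEq.mderivOn ?_ α).eq_of_nhds
    filter_upwards [hk] with x hx
    have hcancel : r x * (qs k x - (qs k x - p x * gs k x)) = gs k x := by
      rw [sub_sub_cancel, ← Matrix.mul_assoc, hx.1, Matrix.one_mul]
    conv_rhs => rw [← hcancel]
    simp [Matrix.mul_apply, sub_eq_add_neg]
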